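/- arXiv:2307.00573 — 4 statements merged into one kernel-verified Lean document; each statement's English description precedes it below -/
import Mathlib

section
/- Let n be a positive integer and set n* = lcm(n, 2). For all integers Q₁ and Q₂, the integer n* divides (n*/n)·Q₁ + (n*/2)·Q₂ if and only if either (Q₂ is even and n divides Q₁) or (Q₂ is odd and n = 2·gcd(n, Q₁)). -/
theorem Int.gcd_two_mul_left_eq_iff {m : ℕ} (hm : 0 < m) (a : ℤ) :
    Int.gcd ((2 * m : ℕ) : ℤ) a = m ↔ ∃ k : ℤ, Odd k ∧ a = m * k := by
  have key (k : ℤ) : Int.gcd ((2 * m : ℕ) : ℤ) (m * k) = m * Int.gcd 2 k := by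
    rw [Nat.cast_mul, mul_comm, Int.gcd_mul_left, Int.natAbs_natCast, Nat.cast_ofNat]
  have odd_iff (k : ℤ) : Int.gcd 2 k = 1 ↔ Odd k := by
    rw [← Int.isCoprime_iff_gcd_eq_one, Int.isCoprime_two_left]
  constructor
  · intro h
    have hdvd : (m : ℤ) ∣ a := by
      have := Int.gcd_dvd_right ((2 * m : ℕ) : ℤ) a
      rwa [h] at this
    obtain ⟨k, rfl⟩ := hdvd
    refine ⟨k, (odd_iff k).1 ?_, rfl⟩
    rw [key] at h
    exact Nat.eq_of_mul_eq_mul_left hm (by rw [h, mul_one])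
  · rintro ⟨k, hk, rfl⟩
    rw [key, (odd_iff k).2 hk, mul_one]

/-- For a positive integer `n`, with `n* = lcm(n, 2)`, and integers `Q₁`, `Q₂`,
the integer `n*` divides `(n*/n)·Q₁ + (n*/2)·Q₂` if and only if either `Q₂` is even and
`n ∣ Q₁`, or `Q₂` is odd and `n = 2·gcd(n, Q₁)`. -/
theorem stmt0 (n : ℕ) (hn : 0 < n) (Q₁ Q₂ : ℤ) :
    ((Nat.lcm n 2 : ℤ) ∣ ((Nat.lcm n 2 / n : ℕ) : ℤ) * Q₁ + ((Nat.lcm n 2 / 2 : ℕ) : ℤ) * Q₂) ↔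
      (Even Q₂ ∧ (n : ℤ) ∣ Q₁) ∨ (Odd Q₂ ∧ n = 2 * Int.gcd (n : ℤ) Q₁) := by
  rcases Nat.even_or_odd' n with ⟨m, rfl | rfl⟩
  · have hm : 0 < m := by lia
    have hlcm : Nat.lcm (2 * m) 2 = 2 * m := Nat.lcm_eq_left (Dvd.intro m rfl)
    have hgcd : 2 * m = 2 * Int.gcd ((2 * m : ℕ) : ℤ) Q₁ ↔ ∃ k : ℤ, Odd k ∧ Q₁ = m * k := by
      rw [← Int.gcd_two_mul_left_eq_iff hm]
      lia
    rw [hlcm, hgcd, Nat.div_self hn, Nat.mul_div_cancel_left m two_pos]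
    push_cast
    rw [one_mul]
    rcases Int.even_or_odd' Q₂ with ⟨j, rfl | rfl⟩
    · have hnot : ¬ Odd (2 * j) := Int.not_odd_iff_even.2 (even_two_mul j)
      have hdvd : (2 * m : ℤ) ∣ m * (2 * j) := ⟨j, by ring⟩
      simp [hnot, dvd_add_left hdvd]
    · have hodd : Odd (2 * j + 1) := odd_two_mul_add_one j
      have hnot : ¬ Even (2 * j + 1) := Int.not_even_iff_odd.2 hodd
      simp only [hnot, hodd, false_and, true_and, false_or]
      constructor
      · rintro ⟨c, hc⟩
        exact ⟨2 * (c - j - 1) + 1, odd_two_mul_add_one _, by linear_combination hc⟩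
      · rintro ⟨_, ⟨c, rfl⟩, rfl⟩
        exact ⟨c + j + 1, by ring⟩
  · have hlcm : Nat.lcm (2 * m + 1) 2 = (2 * m + 1) * 2 :=
      Nat.Coprime.lcm_eq_mul (by simp)
    rw [hlcm, Nat.mul_div_cancel_left 2 hn, Nat.mul_div_cancel _ two_pos]
    have hne : 2 * m + 1 ≠ 2 * Int.gcd ((2 * m + 1 : ℕ) : ℤ) Q₁ := by lia
    simp only [hne, and_false, or_false]
    push_cast
    constructor
    · rintro ⟨c, hc⟩
      have hev : Q₂ = 2 * ((2 * m + 1) * c - Q₁ - m * Q₂) := by linear_combination hc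
      obtain ⟨j, hj⟩ : ∃ j, Q₂ = 2 * j := ⟨_, hev⟩
      subst hj
      exact ⟨even_two_mul j, c - j, by linarith⟩
    · rintro ⟨⟨j, rfl⟩, c, rfl⟩
      exact ⟨c + j, by ring⟩
end

section
/- Let E, G, H be groups, let π : E → G be a surjective group homomorphism with finite kernel, and let f : H → G be a surjective group homomorphism with finite kernel whose cardinality is coprime to the cardinality of ker π. If there exists a group homomorphism s : H → E with π ∘ s = f, then π admits a group-homomorphic section, i.e. there exists a homomorphism σ : G → E with π ∘ σ = id_G. -/
/-- If `π : E → G` is a surjective group homomorphism with finite kernel, `f : H → G` is a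
surjective group homomorphism with finite kernel of cardinality coprime to that of `ker π`,
and the pullback of `π` along `f` splits (i.e. `f` lifts through `π`), then `π` itself splits:
it admits a group-homomorphic section. -/
theorem stmt1 {E G H : Type*} [Group E] [Group G] [Group H]
    (π : E →* G) (f : H →* G)
    (hπsurj : Function.Surjective π) (hfsurj : Function.Surjective f)
    (hπfin : Finite π.ker) (hffin : Finite f.ker)
    (hcop : Nat.Coprime (Nat.card π.ker) (Nat.card f.ker))
    (hlift : ∃ s : H →* E, π.comp s = f) :
    ∃ σ : G →* E, π.comp σ = MonoidHom.id G := by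
  obtain ⟨s, hs⟩ := hlift
  have hker : f.ker ≤ s.ker := by
    intro h hh
    have hsh : s h ∈ π.ker := by
      rw [MonoidHom.mem_ker, ← MonoidHom.comp_apply, hs]
      exact hh
    have h₁ : orderOf (s h) ∣ Nat.card π.ker := Subgroup.orderOf_dvd_natCard _ hsh
    have h₂ : orderOf (s h) ∣ Nat.card f.ker :=
      (orderOf_map_dvd s h).trans (Subgroup.orderOf_dvd_natCard _ hh)
    exact orderOf_eq_one_iff.mp (Nat.eq_one_of_dvd_coprimes hcop h₁ h₂)
  refine ⟨f.liftOfSurjective hfsurj ⟨s, hker⟩, ?_⟩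
  rw [← MonoidHom.cancel_right hfsurj, MonoidHom.comp_assoc, MonoidHom.id_comp,
    MonoidHom.liftOfRightInverse_comp, hs]
end

section
/- Let E be a group and Z a finite subgroup of the center of E. If H₁ and H₂ are finite subgroups of E whose cardinalities are both coprime to the cardinality of Z and whose images under the quotient map E → E/Z coincide, then H₁ = H₂. -/
/-- Let `Z` be a central subgroup. If `H` and `K` have cardinality coprime to that of `Z` and the
image of `H` modulo `Z` is contained in that of `K`, then `H ≤ K`. -/
theorem Subgroup.le_of_image_mk_subset_of_coprime {E : Type*} [Group E] {Z H K : Subgroup E}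
    (hZ : Z ≤ Subgroup.center E) (hH : (Nat.card H).Coprime (Nat.card Z))
    (hK : (Nat.card K).Coprime (Nat.card Z))
    (him : (QuotientGroup.mk : E → E ⧸ Z) '' (H : Set E) ⊆ QuotientGroup.mk '' (K : Set E)) :
    H ≤ K := by
  intro h hh
  obtain ⟨k, hk, hkh⟩ := him ⟨h, hh, rfl⟩
  obtain ⟨z, hz, rfl⟩ : ∃ z ∈ Z, k * z = h :=
    ⟨k⁻¹ * h, QuotientGroup.eq.mp hkh, mul_inv_cancel_left k h⟩
  have hcomm : Commute k z := Subgroup.mem_center_iff.mp (hZ hz) k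
  have pow_card {L : Subgroup E} {x : E} (hx : x ∈ L) : x ^ Nat.card L = 1 :=
    orderOf_dvd_iff_pow_eq_one.mp (L.orderOf_dvd_natCard hx)
  have hz_pow : z ^ (Nat.card H * Nat.card K) = 1 := by
    have hkz : (k * z) ^ (Nat.card H * Nat.card K) = 1 := by
      rw [pow_mul, pow_card hh, one_pow]
    rwa [hcomm.mul_pow, pow_mul', pow_card hk, one_pow, one_mul] at hkz
  have hz_one : z = 1 := by
    simpa [(hH.mul_left hK).gcd_eq_one] using pow_gcd_eq_one.mpr ⟨hz_pow, pow_card hz⟩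
  simpa [hz_one] using hk

/-- Let `Z` be a finite central subgroup of a group `E`. If `H₁, H₂` are finite subgroups of `E`
whose cardinalities are coprime to that of `Z`, and whose images under the quotient map
`E → E ⧸ Z` coincide, then `H₁ = H₂`. -/
theorem stmt3 {E : Type*} [Group E] (Z : Subgroup E) (hZcentral : Z ≤ Subgroup.center E)
    (hZfin : Finite Z) (H₁ H₂ : Subgroup E) (h₁fin : Finite H₁) (h₂fin : Finite H₂)
    (h₁cop : Nat.Coprime (Nat.card H₁) (Nat.card Z))
    (h₂cop : Nat.Coprime (Nat.card H₂) (Nat.card Z))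
    (him : (QuotientGroup.mk : E → E ⧸ Z) '' (H₁ : Set E)
        = (QuotientGroup.mk : E → E ⧸ Z) '' (H₂ : Set E)) :
    H₁ = H₂ := by
  exact le_antisymm
    (Subgroup.le_of_image_mk_subset_of_coprime hZcentral h₁cop h₂cop him.subset)
    (Subgroup.le_of_image_mk_subset_of_coprime hZcentral h₂cop h₁cop him.superset)
end

section
/- Let n be an odd positive integer and let a, b be natural numbers with b < n and a·n + b even; write p for the partition of a·n + b consisting of a parts equal to n together with one part b (omitted if b = 0). If a is even, then b is even and p is a symplectic partition (hence p equals its own C-collapse). If a is odd, then b is odd, and the partition q consisting of a−1 parts equal to n together with one part n−1 and one part b+1 satisfies: q is symplectic, q is dominated by p, and every symplectic partition of a·n + b that is dominated by p is dominated by q; that is, the C-collapse of (n^a b) equals (n^{a−1}, n−1, b+1). -/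
/-- The sum of the `k` largest entries of a multiset of naturals. -/
def topSum (s : Multiset ℕ) (k : ℕ) : ℕ := ((s.sort (· ≥ ·)).take k).sum

/-- `DominatedBy μ λ` means the partition (multiset) `μ` is dominated by `λ` : for every `k`,
the sum of the `k` largest parts of `μ` is at most the sum of the `k` largest parts of `λ`. -/
def DominatedBy (μ l : Multiset ℕ) : Prop := ∀ k, topSum μ k ≤ topSum l k

/-- A partition (multiset of naturals) is symplectic if every odd part occurs with even
multiplicity. -/
def IsSymplectic (s : Multiset ℕ) : Prop := ∀ p, Odd p → Even (s.count p)

theorem topSum_coe {l : List ℕ} (h : l.Pairwise (· ≥ ·)) (k : ℕ) :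
    topSum (l : Multiset ℕ) k = (l.take k).sum := by
  have hs : (l : Multiset ℕ).sort (· ≥ ·) = l :=
    (Multiset.coe_eq_coe.1 (Multiset.sort_eq _ _)).eq_of_pairwise
      (fun _ _ _ _ h₁ h₂ => le_antisymm h₂ h₁) (Multiset.pairwise_sort _ _) h
  rw [topSum, hs]

theorem topSum_le_sum (s : Multiset ℕ) (k : ℕ) : topSum s k ≤ s.sum := by
  conv_rhs => rw [← Multiset.sort_eq s (· ≥ ·), Multiset.sum_coe]
  exact (List.take_sublist _ _).sum_le_sum fun _ _ => Nat.zero_le _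

theorem topSum_le_mul {s : Multiset ℕ} {n : ℕ} (h : ∀ x ∈ s, x ≤ n) (k : ℕ) :
    topSum s k ≤ k * n := by
  have h₁ := List.sum_le_card_nsmul ((s.sort (· ≥ ·)).take k) n fun x hx =>
    h x ((Multiset.mem_sort _).1 (List.mem_of_mem_take hx))
  rw [smul_eq_mul] at h₁
  exact h₁.trans (Nat.mul_le_mul_right _ (List.length_take_le _ _))

theorem le_topSum_one {s : Multiset ℕ} {x : ℕ} (hx : x ∈ s) : x ≤ topSum s 1 := by
  have hp := Multiset.pairwise_sort s (· ≥ ·)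
  rw [← Multiset.mem_sort (r := (· ≥ ·))] at hx
  unfold topSum
  cases hl : s.sort (· ≥ ·) with
  | nil => simp [hl] at hx
  | cons y t =>
    rw [hl] at hx hp
    rcases List.mem_cons.1 hx with rfl | hx
    · simp
    · simpa using List.rel_of_pairwise_cons hp hx

/-- If the parts of `s` are at most `n` and fewer than `k` of them equal `n`, then the `k` largest
parts cannot sum to `k * n`. -/
theorem topSum_lt_mul {s : Multiset ℕ} {n k : ℕ} (hn : 0 < n) (h : ∀ x ∈ s, x ≤ n)
    (hc : s.count n < k) : topSum s k < k * n := by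
  set l := (s.sort (· ≥ ·)).take k with hl
  have hle : ∀ x ∈ l, x ≤ n := fun x hx =>
    h x ((Multiset.mem_sort _).1 (List.mem_of_mem_take hx))
  have hlen : l.length ≤ k := List.length_take_le _ _
  have hcl : l.count n ≤ s.count n := by
    conv_rhs => rw [← Multiset.sort_eq s (· ≥ ·), Multiset.coe_count]
    exact (List.take_sublist _ _).count_le _
  change l.sum < k * n
  by_cases hall : ∀ x ∈ l, x = n
  · have hr := List.eq_replicate_of_mem hall
    have : l.count n = l.length := List.count_eq_length.2 fun x hx => (hall x hx).symm
    rw [hr, List.sum_replicate, smul_eq_mul]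
    exact Nat.mul_lt_mul_of_pos_right (by omega) hn
  · push Not at hall
    obtain ⟨x, hx, hxn⟩ := hall
    have h₁ : (l.map id).sum < (l.map fun _ => n).sum :=
      List.sum_lt_sum _ _ (fun y hy => hle y hy) ⟨x, hx, lt_of_le_of_ne (hle x hx) hxn⟩
    simp only [List.map_id, List.map_const', List.sum_replicate, smul_eq_mul] at h₁
    exact h₁.trans_le (Nat.mul_le_mul_right _ hlen)

theorem count_mul_le_sum (s : Multiset ℕ) (n : ℕ) : s.count n * n ≤ s.sum := by
  have h := Multiset.le_count_iff_replicate_le.1 (le_refl (s.count n))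
  obtain ⟨t, ht⟩ := Multiset.le_iff_exists_add.1 h
  have h' := congrArg Multiset.sum ht
  rw [Multiset.sum_add, Multiset.sum_replicate, smul_eq_mul] at h'
  omega

theorem topSum_replicate_add_singleton {n b : ℕ} (hb : b ≤ n) (a k : ℕ) :
    topSum (Multiset.replicate a n + {b}) k = if k ≤ a then k * n else a * n + b := by
  have hl : (Multiset.replicate a n + {b} : Multiset ℕ) =
      ((List.replicate a n ++ [b] : List ℕ) : Multiset ℕ) := by
    rw [← Multiset.coe_add, Multiset.coe_replicate, Multiset.coe_singleton]
  rw [hl, topSum_coe]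
  · split_ifs with h
    · simp [List.take_append, h]
    · rw [List.take_of_length_le (by simp; omega)]
      simp
  · simp [List.pairwise_append, List.pairwise_replicate, hb]

theorem topSum_replicate_add_pair {n c d : ℕ} (hc : c ≤ n) (hd : d ≤ c) (a k : ℕ) :
    topSum (Multiset.replicate a n + {c, d}) k =
      if k ≤ a then k * n else if k = a + 1 then a * n + c else a * n + c + d := by
  have hl : (Multiset.replicate a n + {c, d} : Multiset ℕ) =
      ((List.replicate a n ++ [c, d] : List ℕ) : Multiset ℕ) := by
    rw [← Multiset.coe_add, Multiset.coe_replicate]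
    rfl
  rw [hl, topSum_coe]
  · split_ifs with h h'
    · simp [List.take_append, h]
    · subst h'
      simp [List.take_append]
    · rw [List.take_of_length_le (by simp; omega)]
      simp [add_assoc]
  · simp [List.pairwise_append, List.pairwise_replicate, hc, hd, hd.trans hc]

/-- Let `n` be an odd positive integer, `b < n`, and `a·n + b` even.  Let `p` be the partition
`(n^a b)` of `a·n + b` (the part `b` omitted if `b = 0`).  If `a` is even then `b` is even and
`p` is symplectic (hence equal to its own C-collapse).  If `a` is odd then `b` is odd, and the
partition `q = (n^{a-1}, n-1, b+1)` is a symplectic partition of `a·n + b`, is dominated by `p`,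
and dominates every symplectic partition of `a·n + b` that is dominated by `p`; i.e. the
C-collapse of `(n^a b)` is `(n^{a-1}, n-1, b+1)`. -/
theorem stmt6 (n a b : ℕ) (hodd : Odd n) (hpos : 0 < n) (hb : b < n)
    (heven : Even (a * n + b)) :
    (Even a → Even b ∧
      IsSymplectic (Multiset.replicate a n + (if b = 0 then 0 else {b}))) ∧
    (Odd a → Odd b ∧
      (Multiset.replicate (a - 1) n + {n - 1, b + 1}).sum = a * n + b ∧
      IsSymplectic (Multiset.replicate (a - 1) n + {n - 1, b + 1}) ∧
      DominatedBy (Multiset.replicate (a - 1) n + {n - 1, b + 1})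
        (Multiset.replicate a n + (if b = 0 then 0 else {b})) ∧
      ∀ m : Multiset ℕ, (∀ x ∈ m, 0 < x) → m.sum = a * n + b → IsSymplectic m →
        DominatedBy m (Multiset.replicate a n + (if b = 0 then 0 else {b})) →
        DominatedBy m (Multiset.replicate (a - 1) n + {n - 1, b + 1})) := by
  refine ⟨fun ha => ?_, fun ha => ?_⟩
  · have hbe : Even b := (Nat.even_add.1 heven).1 (ha.mul_right n)
    refine ⟨hbe, fun p hp => ?_⟩
    have hpb : p ≠ b := fun h => Nat.not_even_iff_odd.2 hp (h ▸ hbe)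
    have h₀ : Multiset.count p (if b = 0 then 0 else {b}) = 0 := by
      split_ifs <;> simp [hpb]
    rw [Multiset.count_add, h₀, Multiset.count_replicate]
    split_ifs <;> simp [ha]
  have hbo : Odd b := by
    by_contra h
    rw [Nat.not_odd_iff_even] at h
    exact Nat.not_even_iff_odd.2 (ha.mul hodd) ((Nat.even_add.1 heven).2 h)
  have hb₀ : b ≠ 0 := hbo.pos.ne'
  have hbn : b + 1 ≤ n - 1 := by
    obtain ⟨i, rfl⟩ := hodd
    obtain ⟨j, rfl⟩ := hbo
    omega
  obtain ⟨c, rfl⟩ : ∃ c, a = c + 1 := ⟨a - 1, by have := ha.pos; omega⟩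
  have hc : Even c := by simpa [Nat.odd_add_one] using ha
  have hmul : (c + 1) * n = c * n + n := Nat.succ_mul c n
  rw [if_neg hb₀, Nat.add_sub_cancel]
  have hsum : (Multiset.replicate c n + {n - 1, b + 1}).sum = (c + 1) * n + b := by
    simp only [Multiset.sum_add, Multiset.sum_replicate, smul_eq_mul,
      Multiset.insert_eq_cons, Multiset.sum_cons, Multiset.sum_singleton]
    omega
  refine ⟨hbo, hsum, fun p hp => ?_, fun k => ?_, fun m _ hm hsymp hdom k => ?_⟩
  · have h₁ : p ≠ n - 1 := fun h => Nat.not_even_iff_odd.2 hp (h ▸ hodd.tsub_odd odd_one)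
    have h₂ : p ≠ b + 1 := fun h => Nat.not_even_iff_odd.2 hp (h ▸ hbo.add_one)
    have h₀ : Multiset.count p {n - 1, b + 1} = 0 := by
      simp [Multiset.insert_eq_cons, h₁, h₂]
    rw [Multiset.count_add, h₀, Multiset.count_replicate]
    split_ifs <;> simp [hc]
  · rw [topSum_replicate_add_singleton hb.le]
    split_ifs
    · refine topSum_le_mul (fun x hx => ?_) k
      simp only [Multiset.mem_add, Multiset.insert_eq_cons, Multiset.mem_cons,
        Multiset.mem_singleton] at hx
      rcases hx with hx | rfl | rfl
      · exact (Multiset.eq_of_mem_replicate hx).le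
      · omega
      · omega
    · exact hsum ▸ topSum_le_sum _ k
  · have hle : ∀ x ∈ m, x ≤ n := fun x hx => by
      have h₁ := hdom 1
      rw [topSum_replicate_add_singleton hb.le, if_pos (by omega), one_mul] at h₁
      exact (le_topSum_one hx).trans h₁
    rw [topSum_replicate_add_pair (by omega) hbn]
    split_ifs with h h'
    · exact topSum_le_mul hle k
    · have hcount : m.count n < c + 1 := by
        by_contra! hge
        have hne : m.count n ≠ c + 1 := fun h =>
          Nat.not_even_iff_odd.2 ha (h ▸ hsymp n hodd)
        have h₁ : (c + 2) * n ≤ m.count n * n := Nat.mul_le_mul_right _ (by omega)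
        have h₂ := count_mul_le_sum m n
        have h₃ : (c + 2) * n = c * n + 2 * n := add_mul c 2 n
        omega
      have h₁ := topSum_lt_mul hpos hle hcount
      subst h'
      omega
    · have h₁ := topSum_le_sum m k
      omega
end
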